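/- arXiv:2110.08108 — 3 statements merged into one kernel-verified Lean document; each statement's English description precedes it below -/
import Mathlib

section
/- For every positive integer n, the sum of mex(π) over all partitions π of n with mex(π) odd equals the number of two-colored distinct-parts partitions of n having an even number of parts. -/
open Finset

/-- The minimal excludant of a partition: the least positive integer not a part. -/
noncomputable def mex {n : ℕ} (π : Nat.Partition n) : ℕ :=
  sInf {m : ℕ | 0 < m ∧ m ∉ π.parts}

/-- Number of partitions of `n` with minimal excludant `m`. -/
noncomputable def pmex (m n : ℕ) : ℕ :=
  ((Finset.univ : Finset (Nat.Partition n)).filter (fun π => mex π = m)).card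

/-- The partition function, extended by `0` on negative integers. -/
noncomputable def pz (k : ℤ) : ℕ := if 0 ≤ k then Fintype.card (Nat.Partition k.toNat) else 0

/-- Number of partitions of `m` into distinct parts. -/
def qdist (m : ℕ) : ℕ := (Nat.Partition.distincts m).card

/-- A two-colored distinct-parts partition of `n`: a set of distinct (part, color)
pairs with positive parts summing to `n`. -/
def IsTCD (n : ℕ) (s : Finset (ℕ × Fin 2)) : Prop :=
  (∀ p ∈ s, 0 < p.1) ∧ ∑ p ∈ s, p.1 = n

noncomputable def D2 (n : ℕ) : ℕ := Set.ncard {s : Finset (ℕ × Fin 2) | IsTCD n s}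
noncomputable def D2e (n : ℕ) : ℕ :=
  Set.ncard {s : Finset (ℕ × Fin 2) | IsTCD n s ∧ Even s.card}
noncomputable def D2o (n : ℕ) : ℕ :=
  Set.ncard {s : Finset (ℕ × Fin 2) | IsTCD n s ∧ Odd s.card}

open PowerSeries

/-- `(q;q)_N`. -/
noncomputable def qq (N : ℕ) : PowerSeries ℤ := ∏ i ∈ range N, (1 - X ^ (i + 1))

/-- the triangular exponent `(k-N)(k-N+1)/2`. -/
def tt : ℕ → ℕ → ℕ
  | k, 0 => k * (k + 1) / 2
  | 0, N + 1 => N * (N + 1) / 2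
  | k + 1, N + 1 => tt k N

theorem tri_succ (k : ℕ) : (k + 1) * (k + 1 + 1) / 2 = k * (k + 1) / 2 + (k + 1) := by
  have : (k + 1) * (k + 1 + 1) = k * (k + 1) + (k + 1) * 2 := by ring
  rw [this, Nat.add_mul_div_right _ _ (by norm_num)]

theorem tt_zero_succ (N : ℕ) : tt 0 (N + 1) = N + tt 0 N := by
  cases N with
  | zero => simp [tt]
  | succ N => simp only [tt]; rw [tri_succ]; omega

theorem tt_succ (k N : ℕ) : N + tt (k + 1) N = tt k N + (k + 1) := by
  induction k generalizing N with
  | zero =>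
    cases N with
    | zero => simp [tt]
    | succ N => rw [tt_zero_succ]; simp [tt]; omega
  | succ k ih =>
    cases N with
    | zero => simp only [tt]; rw [tri_succ]; omega
    | succ N => simp only [tt]; have := ih N; omega

theorem tt_right (N j : ℕ) : tt (N + j) N = j * (j + 1) / 2 := by
  induction N with
  | zero => simp [tt]
  | succ N ih => rw [show N + 1 + j = (N + j) + 1 by ring]; simpa [tt] using ih

theorem tt_left (a j : ℕ) : tt a (a + 1 + j) = j * (j + 1) / 2 := by
  induction a with
  | zero => rw [show 0 + 1 + j = j + 1 by ring]; simp [tt]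
  | succ N ih => rw [show N + 1 + 1 + j = (N + 1 + j) + 1 by ring]; simpa [tt] using ih

theorem qq_succ (N : ℕ) : qq (N + 1) = qq N * (1 - X ^ (N + 1)) := by
  simp [qq, prod_range_succ]

theorem qq_zero : qq 0 = 1 := by simp [qq]

def Good (p : Polynomial (PowerSeries ℤ)) (L N : ℕ) : Prop :=
  (∀ k, L < k → p.coeff k = 0) ∧
    ∀ k l, k + l = L → qq k * qq l * p.coeff k = X ^ tt k N * qq L

theorem good_stepN {p : Polynomial (PowerSeries ℤ)} {L N : ℕ} (h : Good p L N) :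
    Good (p * (Polynomial.X + Polynomial.C (X ^ N))) (L + 1) (N + 1) := by
  obtain ⟨hz, h⟩ := h
  refine ⟨?_, ?_⟩
  · intro k hk
    obtain ⟨k, rfl⟩ : ∃ j, k = j + 1 := ⟨k - 1, by omega⟩
    simp only [mul_add, Polynomial.coeff_add, Polynomial.coeff_mul_C, Polynomial.coeff_mul_X]
    simp [hz k (by omega), hz (k + 1) (by omega)]
  · intro k l hkl
    cases k with
    | zero =>
      obtain rfl : l = L + 1 := by omega
      have h0 := h 0 L (by omega)
      rw [tt_zero_succ, pow_add]
      simp only [mul_add, Polynomial.coeff_add, Polynomial.mul_coeff_zero, Polynomial.coeff_C_zero,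
        Polynomial.coeff_X_zero, qq_succ L]
      linear_combination (1 - X ^ (L + 1)) * X ^ N * h0
    | succ k =>
      simp only [mul_add, Polynomial.coeff_add, Polynomial.coeff_mul_C, Polynomial.coeff_mul_X]
      cases l with
      | zero =>
        obtain rfl : k = L := by omega
        have h0 := h k 0 (by omega)
        rw [hz (k + 1) (by omega), show tt (k + 1) (N + 1) = tt k N from rfl, qq_succ]
        linear_combination (1 - X ^ (k + 1)) * h0
      | succ l =>
        obtain rfl : L = k + l + 1 := by omega
        have h1 := h k (l + 1) (by omega)
        have h2 := h (k + 1) l (by omega)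
        have h3 : (X : PowerSeries ℤ) ^ N * X ^ tt (k + 1) N = X ^ tt k N * X ^ (k + 1) := by
          rw [← pow_add, ← pow_add, tt_succ]
        rw [show tt (k + 1) (N + 1) = tt k N from rfl, qq_succ (k + l + 1)]
        rw [qq_succ] at h1 h2 ⊢
        rw [qq_succ l]
        linear_combination (1 - X ^ (k + 1)) * h1 + X ^ N * (1 - X ^ (l + 1)) * h2
          + (1 - X ^ (l + 1)) * qq (k + l + 1) * h3

theorem good_stepM {p : Polynomial (PowerSeries ℤ)} {M N : ℕ} (h : Good p (M + N) N) :
    Good (p * (1 + Polynomial.C (X ^ (M + 1)) * Polynomial.X)) (M + N + 1) N := by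
  obtain ⟨hz, h⟩ := h
  have e : p * (1 + Polynomial.C (X ^ (M + 1)) * Polynomial.X)
    = p + p * Polynomial.X * Polynomial.C (X ^ (M + 1)) := by ring
  rw [e]
  refine ⟨?_, ?_⟩
  · intro k hk
    obtain ⟨k, rfl⟩ : ∃ j, k = j + 1 := ⟨k - 1, by omega⟩
    simp only [Polynomial.coeff_add, Polynomial.coeff_mul_C, Polynomial.coeff_mul_X]
    simp [hz k (by omega), hz (k + 1) (by omega)]
  · intro k l hkl
    cases k with
    | zero =>
      obtain rfl : l = M + N + 1 := by omega
      have h0 := h 0 (M + N) (by omega)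
      simp only [Polynomial.coeff_add, Polynomial.mul_coeff_zero, Polynomial.coeff_C_zero,
        Polynomial.coeff_X_zero, qq_succ (M + N)]
      linear_combination (1 - X ^ (M + N + 1)) * h0
    | succ k =>
      simp only [Polynomial.coeff_add, Polynomial.coeff_mul_C, Polynomial.coeff_mul_X]
      cases l with
      | zero =>
        obtain rfl : k = M + N := by omega
        have h0 := h (M + N) 0 (by omega)
        have h3 : (X : PowerSeries ℤ) ^ (M + 1) * X ^ tt (M + N) N = X ^ tt (M + N + 1) N := by
          rw [← pow_add]; congr 1; have := tt_succ (M + N) N; omega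
        rw [hz (M + N + 1) (by omega), qq_succ]
        linear_combination (1 - X ^ (M + N + 1)) * X ^ (M + 1) * h0
          + (1 - X ^ (M + N + 1)) * qq (M + N) * h3
      | succ l =>
        have hL : M + N = k + l + 1 := by omega
        have h1 := h k (l + 1) (by omega)
        have h2 := h (k + 1) l (by omega)
        have h3 : (X : PowerSeries ℤ) ^ (M + 1) * X ^ tt k N = X ^ tt (k + 1) N * X ^ (l + 1) := by
          rw [← pow_add, ← pow_add]; congr 1; have := tt_succ k N; omega
        rw [qq_succ (M + N)]
        rw [qq_succ] at h1 h2 ⊢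
        rw [qq_succ l]
        have h4 : (X : PowerSeries ℤ) ^ (M + N + 1) = X ^ (l + 1) * X ^ (k + 1) := by
          rw [← pow_add]; congr 1; omega
        linear_combination (1 - X ^ (l + 1)) * h2 + X ^ (M + 1) * (1 - X ^ (k + 1)) * h1
          + (1 - X ^ (k + 1)) * qq (M + N) * h3 + X ^ tt (k + 1) N * qq (M + N) * h4

/-- the finite theta product -/
noncomputable def HH (M N : ℕ) : Polynomial (PowerSeries ℤ) :=
  (∏ i ∈ range N, (Polynomial.X + Polynomial.C (X ^ i))) *
    ∏ i ∈ range M, (1 + Polynomial.C (X ^ (i + 1)) * Polynomial.X)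

theorem good_HH (M N : ℕ) : Good (HH M N) (M + N) N := by
  induction M with
  | zero =>
    induction N with
    | zero =>
      refine ⟨?_, ?_⟩
      · intro k hk
        simp [HH, Polynomial.coeff_one]; omega
      · intro k l hkl
        obtain ⟨rfl, rfl⟩ : k = 0 ∧ l = 0 := by omega
        simp [HH, qq_zero, tt]
    | succ N ih =>
      have := good_stepN ih
      simpa [HH, prod_range_succ, add_assoc] using this
  | succ M ih =>
    have := good_stepM ih
    rw [show M + 1 + N = M + N + 1 by ring]
    simpa [HH, prod_range_succ, mul_assoc] using this

theorem qq_dvd (a b : ℕ) : (X : PowerSeries ℤ) ^ (a + 1) ∣ qq (a + b) - qq a := by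
  induction b with
  | zero => simp
  | succ b ih =>
    have : qq (a + (b + 1)) - qq a = (qq (a + b) - qq a) - X ^ (a + 1) * (X ^ b * qq (a + b)) := by
      rw [← add_assoc, qq_succ]; ring
    rw [this]
    exact dvd_sub ih (dvd_mul_right _ _)

theorem qq_dvd' (a b N : ℕ) (ha : N ≤ a + 1) (hb : N ≤ b + 1) :
    (X : PowerSeries ℤ) ^ N ∣ qq a - qq b := by
  rcases le_total a b with h | h
  · obtain ⟨c, rfl⟩ := Nat.exists_eq_add_of_le h
    rw [← neg_sub, dvd_neg]
    exact (pow_dvd_pow _ ha).trans (qq_dvd a c)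
  · obtain ⟨c, rfl⟩ := Nat.exists_eq_add_of_le h
    exact (pow_dvd_pow _ hb).trans (qq_dvd b c)

theorem qq_unit (a : ℕ) : IsUnit (qq a) := by
  rw [PowerSeries.isUnit_iff_constantCoeff]
  simp [qq, map_prod]

theorem tt_bound (k l N : ℕ) (h : k + l = N + N) : N ≤ tt k N + k + 1 ∧ N ≤ tt k N + l + 1 := by
  have key : ∀ j : ℕ, j ≤ j * (j + 1) / 2 := by
    intro j
    induction j with
    | zero => simp
    | succ j ih => rw [tri_succ]; omega
  rcases le_or_gt N k with hk | hk
  · obtain ⟨j, rfl⟩ := Nat.exists_eq_add_of_le hk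
    rw [tt_right]; have := key j; omega
  · obtain ⟨j, rfl⟩ : ∃ j, N = k + 1 + j := ⟨N - k - 1, by omega⟩
    rw [tt_left]; have := key j; omega

theorem HH_coeff_mod (N k : ℕ) (hk : k ≤ N + N) :
    (X : PowerSeries ℤ) ^ N ∣ qq N * (HH N N).coeff k - X ^ tt k N := by
  obtain ⟨l, hl⟩ := Nat.exists_eq_add_of_le hk
  have h := (good_HH N N).2 k l hl.symm
  obtain ⟨b1, b2⟩ := tt_bound k l N hl.symm
  have hu : IsUnit (qq k * qq l) := (qq_unit k).mul (qq_unit l)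
  rw [← hu.dvd_mul_left]
  have e : qq k * qq l * (qq N * (HH N N).coeff k - X ^ tt k N)
      = (X ^ tt k N * (qq (N + N) - qq l)) * qq N + X ^ tt k N * (qq N - qq k) * qq l := by
    linear_combination qq N * h
  rw [e]
  have aux : ∀ a b : ℕ, N ≤ tt k N + a + 1 → N ≤ tt k N + b + 1 →
      (X : PowerSeries ℤ) ^ N ∣ X ^ tt k N * (qq a - qq b) := by
    intro a b ha hb
    rcases le_total N (tt k N) with h | h
    · exact (pow_dvd_pow _ h).trans (dvd_mul_right _ _)
    · obtain ⟨c, hc⟩ := Nat.exists_eq_add_of_le h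
      rw [show (X : PowerSeries ℤ) ^ N = X ^ tt k N * X ^ c by rw [← pow_add, ← hc]]
      exact mul_dvd_mul_left _ (qq_dvd' a b c (by omega) (by omega))
  exact dvd_add ((aux _ _ (by omega) b2).mul_right _) ((aux _ _ (by omega) b1).mul_right _)

theorem HH_natDegree (N : ℕ) : (HH N N).natDegree < N + N + 1 := by
  have := (good_HH N N).1
  rw [Nat.lt_succ_iff, Polynomial.natDegree_le_iff_coeff_eq_zero]
  exact this

/-- weighted sum mod `X^N` -/
theorem HH_sum_mod (N : ℕ) (w : ℕ → PowerSeries ℤ) :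
    (X : PowerSeries ℤ) ^ N ∣ qq N * ∑ k ∈ range (N + N + 1), w k * (HH N N).coeff k -
      ∑ j ∈ range N, (w (N + j) + w (N - 1 - j)) * X ^ (j * (j + 1) / 2) := by
  have h1 : (X : PowerSeries ℤ) ^ N ∣ ∑ k ∈ range (N + N + 1),
      w k * (qq N * (HH N N).coeff k - X ^ tt k N) :=
    dvd_sum fun k hk => (HH_coeff_mod N k (by simp at hk; omega)).mul_left _
  have h2 : ∑ k ∈ range (N + N + 1), w k * X ^ tt k N =
      ∑ j ∈ range N, (w (N + j) + w (N - 1 - j)) * (X : PowerSeries ℤ) ^ (j * (j + 1) / 2)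
        + w (N + N) * X ^ (N * (N + 1) / 2) := by
    rw [sum_range_succ, tt_right, sum_range_add]
    congr 1
    rw [← sum_range_reflect (fun x => w x * (X : PowerSeries ℤ) ^ tt x N), ← sum_add_distrib]
    refine sum_congr rfl fun j hj => ?_
    have hj : j < N := by simpa using hj
    rw [tt_right]
    have : tt (N - 1 - j) N = j * (j + 1) / 2 := by
      have := tt_left (N - 1 - j) j
      rwa [show N - 1 - j + 1 + j = N by omega] at this
    rw [this]; ring
  have h3 : (X : PowerSeries ℤ) ^ N ∣ w (N + N) * X ^ (N * (N + 1) / 2) := by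
    refine (pow_dvd_pow _ ?_).mul_left _
    have := (tt_bound (N + N) 0 N (by omega)).2
    rw [tt_right] at this
    cases N with
    | zero => simp
    | succ N => rw [tri_succ]; omega
  have e : qq N * ∑ k ∈ range (N + N + 1), w k * (HH N N).coeff k -
      ∑ j ∈ range N, (w (N + j) + w (N - 1 - j)) * X ^ (j * (j + 1) / 2)
      = ∑ k ∈ range (N + N + 1), w k * (qq N * (HH N N).coeff k - X ^ tt k N)
        + w (N + N) * X ^ (N * (N + 1) / 2) := by
    simp only [mul_sub, sum_sub_distrib]
    rw [h2, mul_sum]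
    have : ∀ k, w k * (qq N * (HH N N).coeff k) = qq N * (w k * (HH N N).coeff k) := by
      intro k; ring
    simp only [this]
    ring
  rw [e]
  exact dvd_add h1 h3

/-- `∏ (1 + z q^i)`. -/
noncomputable def ee (z : PowerSeries ℤ) (N : ℕ) : PowerSeries ℤ :=
  ∏ i ∈ range N, (1 + z * X ^ (i + 1))

theorem gauss_mod (m : ℕ) : (X : PowerSeries ℤ) ^ (m + 1) ∣
    2 * (qq (m + 1) * (ee 1 (m + 1)) ^ 2) -
      2 * ∑ j ∈ range (m + 1), X ^ (j * (j + 1) / 2) := by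
  have h := HH_sum_mod (m + 1) (fun _ => 1)
  have e : ∑ k ∈ range (m + 1 + (m + 1) + 1), 1 * (HH (m + 1) (m + 1)).coeff k
      = 2 * ee 1 m * ee 1 (m + 1) := by
    have := Polynomial.eval_eq_sum_range' (HH_natDegree (m + 1)) 1
    simp only [one_pow, mul_one] at this
    simp only [one_mul]
    rw [← this, HH, Polynomial.eval_mul, Polynomial.eval_prod, Polynomial.eval_prod,
      prod_range_succ']
    simp only [Polynomial.eval_add, Polynomial.eval_X, Polynomial.eval_C, Polynomial.eval_mul,
      Polynomial.eval_one, pow_zero, mul_one, one_mul, ee]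
    ring
  rw [e] at h
  have e2 : ee 1 (m + 1) = ee 1 m * (1 + X ^ (m + 1)) := by simp [ee, prod_range_succ]
  have : 2 * (qq (m + 1) * (ee 1 (m + 1)) ^ 2) -
      2 * ∑ j ∈ range (m + 1), (X : PowerSeries ℤ) ^ (j * (j + 1) / 2) =
      (qq (m + 1) * (2 * ee 1 m * ee 1 (m + 1)) -
        ∑ j ∈ range (m + 1), (1 + 1) * X ^ (j * (j + 1) / 2))
      + X ^ (m + 1) * (2 * qq (m + 1) * ee 1 m * ee 1 (m + 1)) := by
    rw [← mul_sum, sq]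
    nth_rewrite 1 [e2]
    ring
  rw [this]
  exact dvd_add h (dvd_mul_right _ _)

theorem jacobi_mod (m : ℕ) : (X : PowerSeries ℤ) ^ (m + 1) ∣
    qq (m + 1) * (ee (-1) (m + 1)) ^ 2 -
      ∑ j ∈ range (m + 1), (-1 : PowerSeries ℤ) ^ j * (2 * (j : PowerSeries ℤ) + 1) * X ^ (j * (j + 1) / 2) := by
  have h := HH_sum_mod (m + 1) (fun k => (-1) ^ m * (k * (-1) ^ (k - 1)))
  have e : ∑ k ∈ range (m + 1 + (m + 1) + 1),
      (-1) ^ m * (k * (-1) ^ (k - 1)) * (HH (m + 1) (m + 1)).coeff k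
      = ee (-1) m * ee (-1) (m + 1) := by
    have hd : Polynomial.eval (-1) (Polynomial.derivative (HH (m + 1) (m + 1))) =
        ∑ k ∈ range (m + 1 + (m + 1) + 1), (HH (m + 1) (m + 1)).coeff k * k * (-1) ^ (k - 1) := by
      rw [Polynomial.derivative_eval, Polynomial.sum_over_range' _ _ _ (HH_natDegree (m + 1))]
      simp
    have hp : Polynomial.eval (-1) (Polynomial.derivative (HH (m + 1) (m + 1))) =
        (-1) ^ m * (ee (-1) m * ee (-1) (m + 1)) := by
      rw [HH, prod_range_succ', mul_assoc, mul_comm, mul_assoc, Polynomial.derivative_mul]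
      have h1 : ∏ i ∈ range m, (-1 + (X : PowerSeries ℤ) ^ (i + 1)) =
          (-1) ^ m * ∏ i ∈ range m, (1 + -1 * X ^ (i + 1)) := by
        have : ∀ i : ℕ, (-1 + (X : PowerSeries ℤ) ^ (i + 1)) = (-1) * (1 + -1 * X ^ (i + 1)) := by
          intro i; ring
        simp only [this]
        rw [prod_mul_distrib, prod_const, card_range]
      simp only [Polynomial.eval_add, Polynomial.eval_X, Polynomial.eval_C, Polynomial.eval_mul,
        Polynomial.eval_one, Polynomial.derivative_add, Polynomial.derivative_X,
        Polynomial.derivative_C, Polynomial.eval_prod, h1, ee, pow_zero, Polynomial.eval_zero]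
      simp only [neg_add_cancel]
      ring
    have hs : ((-1 : PowerSeries ℤ) ^ m) * (-1) ^ m = 1 := by rw [← mul_pow]; simp
    have : ee (-1) m * ee (-1) (m + 1) = (-1) ^ m * ((-1) ^ m * (ee (-1) m * ee (-1) (m + 1))) := by
      rw [← mul_assoc, hs, one_mul]
    rw [this, ← hp, hd, mul_sum]
    exact sum_congr rfl fun k _ => by ring
  rw [e] at h
  have e2 : ee (-1) (m + 1) = ee (-1) m * (1 - X ^ (m + 1)) := by
    simp [ee, prod_range_succ, sub_eq_add_neg]
  have e3 : ∑ j ∈ range (m + 1), ((-1 : PowerSeries ℤ) ^ m *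
        (((m + 1 + j : ℕ) : PowerSeries ℤ) * (-1) ^ (m + 1 + j - 1)) +
        (-1) ^ m * (((m + 1 - 1 - j : ℕ) : PowerSeries ℤ) * (-1) ^ (m + 1 - 1 - j - 1))) *
          X ^ (j * (j + 1) / 2) =
      ∑ j ∈ range (m + 1), (-1 : PowerSeries ℤ) ^ j * (2 * (j : PowerSeries ℤ) + 1) * X ^ (j * (j + 1) / 2) := by
    refine sum_congr rfl fun j hj => ?_
    congr 1
    have hj : j ≤ m := by simp at hj; omega
    obtain ⟨c, rfl⟩ := Nat.exists_eq_add_of_le hj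
    have hs : ∀ m, ((-1 : PowerSeries ℤ) ^ m) * (-1) ^ m = 1 := by
      intro m; rw [← mul_pow]; simp
    rw [show j + c + 1 + j - 1 = j + c + j by omega, show j + c + 1 - 1 - j = c by omega]
    have hc : (-1 : PowerSeries ℤ) ^ (j + c) * (c * (-1) ^ (c - 1)) = - (c * (-1) ^ j) := by
      cases c with
      | zero => simp
      | succ c =>
        simp only [Nat.add_sub_cancel]
        have := hs c
        simp only [pow_add, pow_one]
        linear_combination (-(-1) ^ j * ((c + 1 : ℕ) : PowerSeries ℤ)) * this
    rw [hc]
    have := hs (j + c)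
    rw [pow_add _ (j + c) j]
    push_cast
    linear_combination (2 * j + c + 1) * (-1) ^ j * this
  rw [e3] at h
  have : qq (m + 1) * (ee (-1) (m + 1)) ^ 2 -
      ∑ j ∈ range (m + 1), (-1 : PowerSeries ℤ) ^ j * (2 * (j : PowerSeries ℤ) + 1) * X ^ (j * (j + 1) / 2) =
      (qq (m + 1) * (ee (-1) m * ee (-1) (m + 1)) -
        ∑ j ∈ range (m + 1), (-1 : PowerSeries ℤ) ^ j * (2 * (j : PowerSeries ℤ) + 1) * X ^ (j * (j + 1) / 2))
      - X ^ (m + 1) * (qq (m + 1) * ee (-1) m * ee (-1) (m + 1)) := by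
    rw [sq]
    nth_rewrite 1 [e2]
    ring
  rw [this]
  exact dvd_sub h (dvd_mul_right _ _)

theorem card_erase_parts {n a : ℕ} (ha : 1 ≤ a) (P Q : Multiset ℕ → Prop)
    [DecidablePred P] [DecidablePred Q] (h : ∀ s, P (a ::ₘ s) ↔ Q s) :
    ((univ : Finset (Nat.Partition n)).filter (fun π => a ∈ π.parts ∧ P π.parts)).card =
      if a ≤ n then ((univ : Finset (Nat.Partition (n - a))).filter (fun π => Q π.parts)).card
      else 0 := by
  classical
  split_ifs with hn
  · have inj : Function.Injective
        (fun σ : Nat.Partition (n - a) => ((Nat.Partition.partitionWithPartEquiv ha hn).symm σ).1) :=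
      Subtype.val_injective.comp (Equiv.injective _)
    rw [← card_image_of_injective _ inj]
    congr 1
    ext π
    simp only [mem_filter, mem_univ, true_and, mem_image]
    constructor
    · rintro ⟨h1, h2⟩
      refine ⟨Nat.Partition.partitionWithPartEquiv ha hn ⟨π, h1⟩, ?_, by simp⟩
      rw [Nat.Partition.partitionWithPartEquiv_apply_parts, ← h, Multiset.cons_erase h1]
      exact h2
    · rintro ⟨σ, h1, rfl⟩
      rw [Nat.Partition.partitionWithPartEquiv_symm_apply_parts, h]
      exact ⟨by simp, h1⟩
  · rw [card_eq_zero, filter_eq_empty_iff]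
    rintro π - ⟨h1, -⟩
    exact hn (Nat.Partition.le_of_mem_parts h1)

noncomputable def PP : PowerSeries ℤ := PowerSeries.mk fun n => (Fintype.card (Nat.Partition n) : ℤ)

noncomputable def rr (N : ℕ) : PowerSeries ℤ := PowerSeries.mk fun n =>
  (((univ : Finset (Nat.Partition n)).filter (fun π => ∀ i ∈ π.parts, i ≤ N)).card : ℤ)

theorem rr_succ (N : ℕ) : rr (N + 1) * (1 - X ^ (N + 1)) = rr N := by
  classical
  ext n
  rw [mul_sub, mul_one, map_sub, coeff_mul_X_pow']
  simp only [rr, coeff_mk]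
  have h1 := card_erase_parts (n := n) (a := N + 1) (by omega) (fun s => ∀ i ∈ s, i ≤ N + 1)
    (fun s => ∀ i ∈ s, i ≤ N + 1) (by simp)
  have h2 := card_filter_add_card_filter_not
    (s := (univ : Finset (Nat.Partition n)).filter (fun π => ∀ i ∈ π.parts, i ≤ N + 1))
    (fun π => N + 1 ∈ π.parts)
  rw [filter_filter, filter_filter] at h2
  have h3 : (univ : Finset (Nat.Partition n)).filter
      (fun π => (∀ i ∈ π.parts, i ≤ N + 1) ∧ N + 1 ∈ π.parts) =
      (univ : Finset (Nat.Partition n)).filter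
      (fun π => N + 1 ∈ π.parts ∧ (∀ i ∈ π.parts, i ≤ N + 1)) := by
    ext; simp [and_comm]
  have h4 : (univ : Finset (Nat.Partition n)).filter
      (fun π => (∀ i ∈ π.parts, i ≤ N + 1) ∧ ¬ N + 1 ∈ π.parts) =
      (univ : Finset (Nat.Partition n)).filter (fun π => ∀ i ∈ π.parts, i ≤ N) := by
    ext π
    simp only [mem_filter, mem_univ, true_and]
    constructor
    · rintro ⟨a, b⟩ i hi
      have := a i hi
      have : i ≠ N + 1 := fun h => b (h ▸ hi)
      omega
    · intro a
      exact ⟨fun i hi => (a i hi).trans (by omega), fun h => by have := a _ h; omega⟩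
  rw [h3, h4, h1] at h2
  split_ifs at h2 ⊢ <;> omega

theorem rr_zero : rr 0 = 1 := by
  ext n
  rw [coeff_one]
  simp only [rr, coeff_mk]
  split_ifs with h
  · subst h
    simp
  · norm_cast
    rw [card_eq_zero, filter_eq_empty_iff]
    rintro π - hπ
    have : π.parts = 0 := Multiset.eq_zero_of_forall_notMem fun i hi => by
      have := hπ i hi
      have := π.parts_pos hi
      omega
    have h2 := π.parts_sum
    rw [this] at h2
    simp at h2
    omega

theorem rr_mul_qq (N : ℕ) : rr N * qq N = 1 := by
  induction N with
  | zero => rw [rr_zero, qq_zero, one_mul]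
  | succ N ih => rw [qq_succ, mul_comm (qq N), ← mul_assoc, rr_succ, ih]

theorem PP_dvd (N : ℕ) : (X : PowerSeries ℤ) ^ (N + 1) ∣ PP * qq N - 1 := by
  have : PP * qq N - 1 = (PP - rr N) * qq N := by rw [sub_mul, rr_mul_qq]
  rw [this]
  refine Dvd.dvd.mul_right ?_ _
  rw [X_pow_dvd_iff]
  intro m hm
  simp only [PP, rr, map_sub, coeff_mk]
  rw [filter_true_of_mem, card_univ, sub_self]
  intro π _ i hi
  have := Nat.Partition.le_of_mem_parts hi
  omega

theorem cc_eq (m n : ℕ) :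
    (((univ : Finset (Nat.Partition n)).filter
      (fun π => ∀ i ∈ Icc 1 m, i ∈ π.parts)).card : ℤ) = coeff n (PP * X ^ (m * (m + 1) / 2)) := by
  induction m generalizing n with
  | zero => simp [PP]
  | succ m ih =>
    have : DecidablePred (fun s : Multiset ℕ => ∀ i ∈ Icc 1 m, i ∈ s) := fun s =>
      inferInstanceAs (Decidable (∀ i ∈ Icc 1 m, i ∈ s))
    have h1 := card_erase_parts (n := n) (a := m + 1) (by omega) (fun s : Multiset ℕ => ∀ i ∈ Icc 1 m, i ∈ s)
      (fun s : Multiset ℕ => ∀ i ∈ Icc 1 m, i ∈ s) (by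
        intro s
        refine forall₂_congr fun i hi => ?_
        have : i ≠ m + 1 := by simp at hi; omega
        simp [this])
    have h2 : (univ : Finset (Nat.Partition n)).filter (fun π => ∀ i ∈ Icc 1 (m + 1), i ∈ π.parts)
      = (univ : Finset (Nat.Partition n)).filter
        (fun π => m + 1 ∈ π.parts ∧ ∀ i ∈ Icc 1 m, i ∈ π.parts) := by
      ext π
      simp only [mem_filter, mem_univ, true_and, mem_Icc]
      constructor
      · intro h
        exact ⟨h _ (by omega), fun i hi => h i (by omega)⟩
      · rintro ⟨a, b⟩ i hi
        rcases Nat.lt_or_ge m i with h | h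
        · obtain rfl : i = m + 1 := by omega
          exact a
        · exact b i (by omega)
    have h1' : ((univ : Finset (Nat.Partition n)).filter
        (fun π => m + 1 ∈ π.parts ∧ ∀ i ∈ Icc 1 m, i ∈ π.parts)).card = if m + 1 ≤ n then
        ((univ : Finset (Nat.Partition (n - (m + 1)))).filter
          (fun π => ∀ i ∈ Icc 1 m, i ∈ π.parts)).card else 0 := by
      convert h1
    rw [h2, h1', tri_succ, pow_add, ← mul_assoc, coeff_mul_X_pow', ← ih]
    split_ifs
    · congr!
    · simp

theorem lt_mex_iff {n : ℕ} (π : Nat.Partition n) (k : ℕ) :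
    k < mex π ↔ ∀ i ∈ Icc 1 k, i ∈ π.parts := by
  have hne : {m : ℕ | 0 < m ∧ m ∉ π.parts}.Nonempty :=
    ⟨n + 1, by omega, fun h => by have := Nat.Partition.le_of_mem_parts h; omega⟩
  constructor
  · intro h i hi
    by_contra hc
    have : mex π ≤ i := Nat.sInf_le ⟨by simp at hi; omega, hc⟩
    simp at hi; omega
  · intro h
    by_contra hc
    have hm : 0 < mex π ∧ mex π ∉ π.parts := Nat.sInf_mem hne
    exact hm.2 (h _ (by simp; omega))

theorem mex_le {n : ℕ} (π : Nat.Partition n) : mex π ≤ n + 1 :=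
  Nat.sInf_le ⟨by omega, fun h => by have := Nat.Partition.le_of_mem_parts h; omega⟩

def gg (k : ℕ) : ℤ := 1 + (-1) ^ k * (2 * k + 1)

theorem sum_gg (m : ℕ) : ∑ k ∈ range m, gg k = 2 * (if Odd m then (m : ℤ) else 0) := by
  induction m with
  | zero => simp
  | succ m ih =>
    rw [sum_range_succ, ih, gg]
    rcases Nat.even_or_odd m with h | h
    · rw [if_neg (by simpa using h), if_pos h.add_one, h.neg_one_pow]; push_cast; ring
    · rw [if_pos h, if_neg (by simpa using h.add_one), h.neg_one_pow]; push_cast; ring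

theorem lhs_eq (n : ℕ) :
    2 * ((∑ π ∈ Finset.univ.filter (fun π : Nat.Partition n => Odd (mex π)), mex π : ℕ) : ℤ) =
      coeff n (PP * ∑ k ∈ range (n + 1), C (gg k) * X ^ (k * (k + 1) / 2)) := by
  classical
  have h1 : ∀ π : Nat.Partition n, 2 * (if Odd (mex π) then (mex π : ℤ) else 0) =
      ∑ k ∈ range (n + 1), if k < mex π then gg k else 0 := by
    intro π
    rw [← sum_gg, ← sum_filter]
    congr 1
    ext k
    have := mex_le π
    simp; omega
  rw [sum_filter]
  push_cast
  rw [mul_sum]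
  simp only [h1]
  rw [sum_comm, mul_sum, map_sum]
  refine sum_congr rfl fun k _ => ?_
  rw [mul_left_comm, coeff_C_mul, ← cc_eq, ← sum_filter, sum_const, nsmul_eq_mul, mul_comm]
  simp only [lt_mex_iff]

theorem ee_sq (w : ℤ) (N : ℕ) : ee (C w) N ^ 2 =
    ∑ t ∈ (Ico 1 (N + 1) ×ˢ (univ : Finset (Fin 2))).powerset,
      C (w ^ t.card) * X ^ (∑ p ∈ t, p.1) := by
  have h : ee (C w) N ^ 2 =
      ∏ p ∈ Ico 1 (N + 1) ×ˢ (univ : Finset (Fin 2)), (1 + C w * X ^ p.1) := by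
    rw [prod_product, prod_Ico_eq_prod_range, ee, ← prod_pow]
    simp [add_comm]
  rw [h, prod_one_add]
  refine sum_congr rfl fun t _ => ?_
  rw [prod_mul_distrib, prod_const, prod_pow_eq_pow_sum, map_pow]

theorem D2e_eq (n : ℕ) : 2 * (D2e n : ℤ) =
    coeff n (ee 1 (n + 1) ^ 2 + ee (-1) (n + 1) ^ 2) := by
  classical
  have hs : {s : Finset (ℕ × Fin 2) | IsTCD n s ∧ Even s.card} =
      (((Ico 1 (n + 1 + 1) ×ˢ (univ : Finset (Fin 2))).powerset.filter
        (fun t => ∑ p ∈ t, p.1 = n ∧ Even t.card) : Finset (Finset (ℕ × Fin 2))) :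
        Set (Finset (ℕ × Fin 2))) := by
    ext t
    simp only [Set.mem_ofPred_eq, coe_filter, mem_powerset, IsTCD]
    constructor
    · rintro ⟨⟨a, b⟩, c⟩
      refine ⟨fun p hp => ?_, b, c⟩
      have h1 := a p hp
      have h2 : p.1 ≤ ∑ p ∈ t, p.1 := single_le_sum (f := fun p : ℕ × Fin 2 => p.1)
        (fun _ _ => Nat.zero_le _) hp
      simp only [mem_product, mem_Ico, mem_univ, and_true]
      omega
    · rintro ⟨a, b, c⟩
      refine ⟨⟨fun p hp => ?_, b⟩, c⟩
      have := a hp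
      simp only [mem_product, mem_Ico, mem_univ, and_true] at this
      omega
  have e1 := ee_sq 1 (n + 1)
  have e2 := ee_sq (-1) (n + 1)
  rw [map_one] at e1
  rw [map_neg, map_one] at e2
  rw [D2e, hs, Set.ncard_coe_finset, e1, e2, ← sum_add_distrib, map_sum, card_filter]
  push_cast
  rw [mul_sum]
  refine sum_congr rfl fun t _ => ?_
  rw [map_add, coeff_C_mul, coeff_C_mul, coeff_X_pow]
  by_cases h : ∑ p ∈ t, p.1 = n
  · rcases Nat.even_or_odd t.card with h' | h'
    · simp [h, h', h'.neg_one_pow]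
    · have : ¬ Even t.card := by simpa using h'
      simp [h, this, h'.neg_one_pow]
  · have h' : ¬ n = ∑ p ∈ t, p.1 := fun e => h e.symm
    simp [h, h']

theorem sigma_odd_mex_eq_D2e (n : ℕ) (hn : 0 < n) :
    ∑ π ∈ Finset.univ.filter (fun π : Nat.Partition n => Odd (mex π)), mex π = D2e n := by
  have h1 := lhs_eq n
  have h2 := D2e_eq n
  have hg := gauss_mod n
  have hj := jacobi_mod n
  have hP : (X : PowerSeries ℤ) ^ (n + 1) ∣ PP * qq (n + 1) - 1 :=
    (pow_dvd_pow _ (by omega)).trans (PP_dvd (n + 1))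
  have hS : ∑ k ∈ range (n + 1), C (gg k) * (X : PowerSeries ℤ) ^ (k * (k + 1) / 2) =
      ∑ j ∈ range (n + 1), X ^ (j * (j + 1) / 2) + ∑ j ∈ range (n + 1),
        (-1 : PowerSeries ℤ) ^ j * (2 * (j : PowerSeries ℤ) + 1) * X ^ (j * (j + 1) / 2) := by
    rw [← sum_add_distrib]
    refine sum_congr rfl fun k _ => ?_
    simp [gg]
    ring
  rw [hS] at h1
  set S1 := ∑ j ∈ range (n + 1), (X : PowerSeries ℤ) ^ (j * (j + 1) / 2)
  set S2 := ∑ j ∈ range (n + 1),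
        (-1 : PowerSeries ℤ) ^ j * (2 * (j : PowerSeries ℤ) + 1) * X ^ (j * (j + 1) / 2)
  have hd : (X : PowerSeries ℤ) ^ (n + 1) ∣
      2 * (PP * (S1 + S2)) - 2 * (ee 1 (n + 1) ^ 2 + ee (-1) (n + 1) ^ 2) := by
    have e : 2 * (PP * (S1 + S2)) - 2 * (ee 1 (n + 1) ^ 2 + ee (-1) (n + 1) ^ 2) =
        (PP * qq (n + 1) - 1) * (2 * (ee 1 (n + 1) ^ 2 + ee (-1) (n + 1) ^ 2))
        - (2 * (qq (n + 1) * (ee 1 (n + 1)) ^ 2) - 2 * S1) * PP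
        - (qq (n + 1) * (ee (-1) (n + 1)) ^ 2 - S2) * (2 * PP) := by ring
    rw [e]
    exact dvd_sub (dvd_sub (hP.mul_right _) (hg.mul_right _)) (hj.mul_right _)
  have h0 := X_pow_dvd_iff.1 hd n (by omega)
  have h2C : (2 : PowerSeries ℤ) = C 2 := by simp
  rw [map_sub, h2C, coeff_C_mul, coeff_C_mul, ← h1, ← h2] at h0
  omega
end

section
/- For every positive integer n, the sum of mex(π) over all partitions π of n with mex(π) even equals the number of two-colored distinct-parts partitions of n having an odd number of parts. -/
open Finset

namespace TCD
def ch (S : Finset ℤ) : ℤ := ∑ x ∈ S, if 0 < x then 1 else -1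
def w (S : Finset ℤ) : ℤ := ∑ x ∈ S, |x|
def B (k n : ℤ) : Set (Finset ℤ) := {S | ch S = k ∧ w S = n}
def C (k n : ℤ) : Set (Finset ℤ) := {S | 0 ∉ S ∧ ch S = k ∧ w S = n}
def D (K : ℕ) (N : ℤ) : Set (Finset ℤ) :=
  {S | (∀ x ∈ S, 0 < x) ∧ S.card = K ∧ 2 * ∑ x ∈ S, x = 2 * N + K * (K + 1)}
def P (K : ℕ) (N : ℤ) : Set (Multiset ℕ) := {s | (∀ x ∈ s, 0 < x ∧ x ≤ K) ∧ (s.sum : ℤ) = N}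
def Q (N : ℤ) : Set (Multiset ℕ) := {s | (∀ x ∈ s, 0 < x) ∧ (s.sum : ℤ) = N}

def sh : Finset ℤ ≃ Finset ℤ := (Equiv.addRight (1 : ℤ)).finsetCongr

lemma sh_eq (S : Finset ℤ) : sh S = S.map (Equiv.addRight (1 : ℤ)).toEmbedding := rfl

lemma mem_sh (S : Finset ℤ) (x : ℤ) : x ∈ sh S ↔ x - 1 ∈ S := by
  simp [sh_eq, sub_eq_add_neg]

lemma sum_sh (S : Finset ℤ) (f : ℤ → ℤ) : ∑ x ∈ sh S, f x = ∑ x ∈ S, f (x + 1) := by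
  simp [sh_eq]

lemma card_sh (S : Finset ℤ) : (sh S).card = S.card := by
  simp [sh_eq]

def tw : Finset ℤ ≃ Finset ℤ :=
  sh.trans (Function.Involutive.toPerm (fun S => symmDiff S {1})
    (fun S => by simp))

lemma tw_eq (S : Finset ℤ) : tw S = symmDiff (sh S) {1} := rfl

lemma encard_eq {α β : Type*} (e : α ≃ β) (A : Set α) (A' : Set β)
    (h : ∀ x, x ∈ A ↔ e x ∈ A') : A.encard = A'.encard := by
  rw [← e.injective.encard_image A]
  congr 1
  ext y
  constructor
  · rintro ⟨x, hx, rfl⟩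
    exact (h x).1 hx
  · intro hy
    exact ⟨e.symm y, (h _).2 (by simpa using hy), by simp⟩

lemma sum_shift_abs (S : Finset ℤ) (h : 0 ∉ S) : w (sh S) = w S + ch S := by
  unfold w ch
  rw [sum_sh, ← Finset.sum_add_distrib]
  apply Finset.sum_congr rfl
  intro x hx
  have : x ≠ 0 := fun h' => h (h' ▸ hx)
  split_ifs with h1
  · rw [abs_of_pos h1, abs_of_pos (by linarith)]
  · have h2 : x < 0 := by omega
    have h3 : x + 1 ≤ 0 := by omega
    rw [abs_of_neg h2, abs_of_nonpos h3]; ring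

lemma ch_shift (S : Finset ℤ) (h : 0 ∉ S) : ch (sh S) = ch S := by
  unfold ch
  rw [sum_sh]
  apply Finset.sum_congr rfl
  intro x hx
  have : x ≠ 0 := fun h' => h (h' ▸ hx)
  have h2 : 0 < x + 1 ↔ 0 < x := by omega
  simp only [h2]

lemma ch_insert (S : Finset ℤ) (a : ℤ) (h : a ∉ S) :
    ch (insert a S) = (if 0 < a then 1 else -1) + ch S := by
  unfold ch; rw [Finset.sum_insert h]

lemma w_insert (S : Finset ℤ) (a : ℤ) (h : a ∉ S) : w (insert a S) = |a| + w S := by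
  unfold w; rw [Finset.sum_insert h]

lemma tw_spec (S : Finset ℤ) : ch (tw S) = ch S + 1 ∧ w (tw S) = w S + ch S + 1 := by
  by_cases h : (0 : ℤ) ∈ S
  · obtain ⟨S', hS', rfl⟩ : ∃ S', 0 ∉ S' ∧ S = insert 0 S' :=
      ⟨S.erase 0, by simp, by simp [h]⟩
    have : tw (insert 0 S') = sh S' := by
      ext x
      simp only [tw_eq, Finset.mem_symmDiff, mem_sh, Finset.mem_insert, Finset.mem_singleton]
      have : x = 1 → x - 1 ∉ S' := by rintro rfl; simpa using hS'
      have h2 : x - 1 = 0 ↔ x = 1 := by omega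
      rw [h2]
      tauto
    rw [this, ch_shift _ hS', sum_shift_abs _ hS', ch_insert _ _ hS', w_insert _ _ hS']
    simp
    ring
  · have h1 : (1 : ℤ) ∉ sh S := by simpa [mem_sh] using h
    have : tw S = insert 1 (sh S) := by
      ext x
      simp only [tw_eq, Finset.mem_symmDiff, Finset.mem_insert, Finset.mem_singleton]
      have : x = 1 → x ∉ sh S := by rintro rfl; exact h1
      tauto
    rw [this, ch_insert _ _ h1, w_insert _ _ h1, ch_shift _ h, sum_shift_abs _ h]
    simp
    constructor <;> ring

lemma B_shift (k n : ℤ) : (B k n).encard = (B (k+1) (n+k+1)).encard := by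
  apply encard_eq tw
  intro S
  obtain ⟨h1, h2⟩ := tw_spec S
  simp only [B, Set.mem_ofPred_eq, h1, h2]
  constructor <;> rintro ⟨h, h'⟩ <;> constructor <;> linarith

lemma B_iter (k n : ℤ) (m : ℕ) : ∀ n' : ℤ, 2 * n' = 2 * n + 2 * m * k + m * (m+1) →
    (B k n).encard = (B (k+m) n').encard := by
  induction m with
  | zero => intro n' h; have : n' = n := by push_cast at h; linarith
            simp [this]
  | succ m ih =>
    intro n' h
    push_cast at h
    rw [ih (n' - (k + m) - 1) (by linarith), B_shift]
    push_cast
    congr 2 <;> ring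

lemma B_split (k n : ℤ) : (B k n).encard = (C k n).encard + (C (k+1) n).encard := by
  have h : B k n = C k n ∪ (insert 0) '' (C (k+1) n) := by
    ext S
    constructor
    · rintro ⟨h1, h2⟩
      by_cases h : (0 : ℤ) ∈ S
      · right
        have he := Finset.insert_erase h
        have h0 : 0 ∉ S.erase 0 := by simp
        rw [← he, ch_insert _ _ h0] at h1
        rw [← he, w_insert _ _ h0] at h2
        refine ⟨S.erase 0, ⟨h0, ?_, ?_⟩, he⟩
        · simp at h1; linarith
        · simpa using h2
      · left; exact ⟨h, h1, h2⟩
    · rintro (⟨_, h1, h2⟩ | ⟨S', ⟨h0, h1, h2⟩, rfl⟩)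
      · exact ⟨h1, h2⟩
      · refine ⟨?_, ?_⟩
        · rw [ch_insert _ _ h0, h1]; simp
        · rw [w_insert _ _ h0, h2]; simp
  rw [h, Set.encard_union_eq, Set.InjOn.encard_image]
  · rintro S ⟨hS, _⟩ S' ⟨hS', _⟩ h
    have := congrArg (fun T => Finset.erase T 0) h
    simpa [hS, hS'] using this
  · rw [Set.disjoint_left]
    rintro S ⟨hS, _⟩ ⟨S', _, rfl⟩
    simp at hS

lemma C_neg (S : Finset ℤ) (h : 0 ∉ S) :
    ch ((Equiv.neg ℤ).finsetCongr S) = - ch S ∧ w ((Equiv.neg ℤ).finsetCongr S) = w S := by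
  constructor
  · unfold ch
    simp only [Equiv.finsetCongr_apply, Finset.sum_map, ← Finset.sum_neg_distrib]
    apply Finset.sum_congr rfl
    intro x hx
    have : x ≠ 0 := fun h' => h (h' ▸ hx)
    simp only [Equiv.coe_toEmbedding, Equiv.neg_apply]
    split_ifs <;> omega
  · unfold w
    simp

lemma tri_le (K : ℕ) : ∀ S : Finset ℤ, (∀ x ∈ S, 0 < x) → S.card = K →
    (K : ℤ) * (K + 1) ≤ 2 * ∑ x ∈ S, x := by
  induction K with
  | zero => intro S _ h; rw [Finset.card_eq_zero] at h; simp [h]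
  | succ K ih =>
    intro S hS hc
    have hne : S.Nonempty := by rw [← Finset.card_pos]; omega
    have hm := S.max'_mem hne
    set M := S.max' hne with hM
    have h1 := ih (S.erase M) (fun x hx => hS x (Finset.mem_of_mem_erase hx))
      (by rw [Finset.card_erase_of_mem hm]; omega)
    have h2 : S ⊆ Finset.Icc 1 M := by
      intro x hx
      rw [Finset.mem_Icc]
      exact ⟨hS x hx, S.le_max' x hx⟩
    have h3 := Finset.card_le_card h2
    have h4 := hS M hm
    have h5 : ((K : ℤ) + 1) ≤ M := by
      simp at h3; omega
    rw [← Finset.add_sum_erase S (fun x => x) hm]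
    push_cast
    linarith

lemma D_neg (K : ℕ) (N : ℤ) (h : N < 0) : D K N = ∅ := by
  ext S
  simp only [D, Set.mem_ofPred_eq, Set.mem_empty_iff_false, iff_false]
  rintro ⟨h1, h2, h3⟩
  have := tri_le K S h1 h2
  linarith

lemma D_rec (K : ℕ) (N : ℤ) :
    (D (K+1) N).encard = (D K N).encard + (D (K+1) (N - (K+1))).encard := by
  have h1 : ∀ S : Finset ℤ, (∀ x ∈ S, 0 < x) → (1 : ℤ) ∉ sh S := by
    intro S hS h
    rw [mem_sh] at h
    have := hS _ h
    simp at this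
  have h : D (K+1) N = (fun S => insert 1 (sh S)) '' (D K N) ∪ sh '' (D (K+1) (N - (K+1))) := by
    ext S
    constructor
    · rintro ⟨a, b, c⟩
      by_cases h : (1 : ℤ) ∈ S
      · left
        obtain ⟨T, hT⟩ := sh.surjective (S.erase 1)
        have he : insert 1 (sh T) = S := by rw [hT, Finset.insert_erase h]
        have hn : (1 : ℤ) ∉ sh T := by simp [hT]
        have hc := b
        rw [← he, Finset.card_insert_of_notMem hn, card_sh] at hc
        have hcc : T.card = K := by omega
        refine ⟨T, ⟨?_, hcc, ?_⟩, he⟩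
        · intro x hx
          have h2 : x + 1 ∈ sh T := by rw [mem_sh]; simpa using hx
          have := a (x+1) (he ▸ Finset.mem_insert_of_mem h2)
          have : x + 1 ≠ 1 := fun h => hn (h ▸ h2)
          omega
        · rw [← he, Finset.sum_insert hn, sum_sh, Finset.sum_add_distrib] at c
          simp [hcc] at c
          linarith
      · right
        obtain ⟨T, rfl⟩ := sh.surjective S
        rw [card_sh] at b
        refine ⟨T, ⟨?_, b, ?_⟩, rfl⟩
        · intro x hx
          have h2 : x + 1 ∈ sh T := by rw [mem_sh]; simpa using hx
          have := a (x+1) h2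
          have : x + 1 ≠ 1 := fun h' => h (h' ▸ h2)
          omega
        · rw [sum_sh, Finset.sum_add_distrib] at c
          simp [b] at c ⊢
          linarith
    · rintro (⟨T, ⟨a, b, c⟩, rfl⟩ | ⟨T, ⟨a, b, c⟩, rfl⟩)
      · have hn := h1 T a
        refine ⟨?_, ?_, ?_⟩
        · intro x hx
          rcases Finset.mem_insert.1 hx with rfl | hx
          · simp
          · have := a _ ((mem_sh _ _).1 hx); omega
        · rw [Finset.card_insert_of_notMem hn, card_sh, b]
        · rw [Finset.sum_insert hn, sum_sh, Finset.sum_add_distrib]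
          simp [b]
          linarith
      · refine ⟨?_, ?_, ?_⟩
        · intro x hx
          have := a _ ((mem_sh _ _).1 hx); omega
        · rw [card_sh, b]
        · rw [sum_sh, Finset.sum_add_distrib]
          simp [b] at c ⊢
          linarith
  rw [h, Set.encard_union_eq, Set.InjOn.encard_image, sh.injective.encard_image]
  · rintro S ⟨hS, _⟩ S' ⟨hS', _⟩ h
    have := congrArg (fun T => Finset.erase T 1) h
    simpa [h1 _ hS, h1 _ hS'] using this
  · rw [Set.disjoint_left]
    rintro _ ⟨S, ⟨hS, _⟩, rfl⟩ ⟨S', ⟨hS', _⟩, h⟩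
    exact h1 _ hS' (h ▸ Finset.mem_insert_self _ _)

lemma P_neg (K : ℕ) (N : ℤ) (h : N < 0) : P K N = ∅ := by
  ext S
  simp only [P, Set.mem_ofPred_eq, Set.mem_empty_iff_false, iff_false]
  rintro ⟨h1, h2⟩
  omega

lemma P_rec (K : ℕ) (N : ℤ) :
    (P (K+1) N).encard = (P K N).encard + (P (K+1) (N - (K+1))).encard := by
  have h : P (K+1) N = P K N ∪ (fun s => (K+1) ::ₘ s) '' (P (K+1) (N - (K+1))) := by
    ext s
    constructor
    · rintro ⟨a, b⟩
      by_cases h : K + 1 ∈ s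
      · right
        obtain ⟨t, rfl⟩ := Multiset.exists_cons_of_mem h
        refine ⟨t, ⟨fun x hx => a x (Multiset.mem_cons_of_mem hx), ?_⟩, rfl⟩
        rw [Multiset.sum_cons] at b
        push_cast [-Nat.cast_multiset_sum] at b
        linarith
      · left
        refine ⟨fun x hx => ⟨(a x hx).1, ?_⟩, b⟩
        have := (a x hx).2
        have : x ≠ K + 1 := fun h' => h (h' ▸ hx)
        omega
    · rintro (⟨a, b⟩ | ⟨t, ⟨a, b⟩, rfl⟩)
      · exact ⟨fun x hx => ⟨(a x hx).1, (a x hx).2.trans (by omega)⟩, b⟩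
      · refine ⟨?_, ?_⟩
        · intro x hx
          rcases Multiset.mem_cons.1 hx with rfl | hx
          · omega
          · exact a x hx
        · rw [Multiset.sum_cons]
          push_cast [-Nat.cast_multiset_sum]
          linarith
  rw [h, Set.encard_union_eq, Function.Injective.encard_image]
  · intro s t h; simpa using h
  · rw [Set.disjoint_left]
    rintro _ ⟨a, _⟩ ⟨s, _, rfl⟩
    have := (a (K+1) (Multiset.mem_cons_self _ _)).2
    omega

lemma D_eq_P (K : ℕ) : ∀ N : ℤ, (D K N).encard = (P K N).encard := by
  induction K with
  | zero =>
    intro N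
    by_cases h : N = 0
    · have h1 : D 0 N = {∅} := by
        ext S
        simp only [D, Set.mem_ofPred_eq, Set.mem_singleton_iff, Finset.card_eq_zero]
        constructor
        · rintro ⟨_, h, _⟩; exact h
        · rintro rfl; simp [h]
      have h2 : P 0 N = {0} := by
        ext S
        simp only [P, Set.mem_ofPred_eq, Set.mem_singleton_iff]
        constructor
        · rintro ⟨a, _⟩
          apply Multiset.eq_zero_of_forall_notMem
          intro x hx; have := a x hx; omega
        · rintro rfl; simp [h]
      rw [h1, h2]; simp
    · have h1 : D 0 N = ∅ := by
        ext S
        simp only [D, Set.mem_ofPred_eq, Set.mem_empty_iff_false, iff_false, Finset.card_eq_zero]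
        rintro ⟨_, rfl, c⟩
        simp at c
        exact h c
      have h2 : P 0 N = ∅ := by
        ext S
        simp only [P, Set.mem_ofPred_eq, Set.mem_empty_iff_false, iff_false]
        rintro ⟨a, c⟩
        have : S = 0 := by
          apply Multiset.eq_zero_of_forall_notMem
          intro x hx; have := a x hx; omega
        subst this
        simp at c
        exact h c.symm
      rw [h1, h2]; simp
  | succ K ih =>
    have key : ∀ m : ℕ, ∀ N : ℤ, N < m → (D (K+1) N).encard = (P (K+1) N).encard := by
      intro m
      induction m with
      | zero => intro N hN; rw [D_neg _ _ (by simpa using hN), P_neg _ _ (by simpa using hN)]; simp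
      | succ m ihm =>
        intro N hN
        rw [D_rec, P_rec, ih, ihm]
        push_cast at hN
        linarith
    intro N
    apply key (N.toNat + 1)
    have := Int.self_le_toNat N
    push_cast
    linarith

lemma P_eq_Q (K : ℕ) (N : ℤ) (h : N ≤ K) : P K N = Q N := by
  ext s
  constructor
  · rintro ⟨a, b⟩; exact ⟨fun x hx => (a x hx).1, b⟩
  · rintro ⟨a, b⟩
    refine ⟨fun x hx => ⟨a x hx, ?_⟩, b⟩
    have := Multiset.single_le_sum (fun x _ => Nat.zero_le x) x hx
    omega

lemma B_eq_D (K : ℕ) (N n : ℤ) (hK : N < K + 1) (hn : 2 * n = 2 * N + K * (K+1)) :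
    B K n = D K N := by
  ext S
  constructor
  · rintro ⟨h1, h2⟩
    have hpos : ∀ x ∈ S, 0 < x := by
      by_contra hcon
      push Not at hcon
      obtain ⟨y, hy, hy0⟩ := hcon
      have hsplit : ch S = ((S.filter (0 < ·)).card : ℤ) - (S.filter (¬ 0 < ·)).card := by
        unfold ch
        rw [Finset.sum_ite]
        simp
        ring
      have hc : 1 ≤ (S.filter (¬ 0 < ·)).card := by
        rw [Nat.succ_le_iff, Finset.card_pos]
        exact ⟨y, by simp [hy, hy0]⟩
      have ht := tri_le _ (S.filter (0 < ·)) (by simp) rfl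
      have hw : ∑ x ∈ S.filter (0 < ·), x ≤ w S := by
        unfold w
        refine (Finset.sum_le_sum (fun x _ => le_abs_self x)).trans ?_
        exact Finset.sum_le_sum_of_subset_of_nonneg (Finset.filter_subset _ _)
          (fun x _ _ => abs_nonneg x)
      have hk : (K : ℤ) + 1 ≤ ((S.filter (0 < ·)).card : ℤ) := by
        have : (1:ℤ) ≤ (S.filter (¬ 0 < ·)).card := by exact_mod_cast hc
        linarith
      nlinarith
    have hw : w S = ∑ x ∈ S, x := Finset.sum_congr rfl (fun x hx => abs_of_pos (hpos x hx))
    have hch : ch S = S.card := by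
      unfold ch
      rw [Finset.sum_congr rfl (fun x hx => if_pos (hpos x hx))]
      simp
    exact ⟨hpos, by exact_mod_cast hch.symm.trans h1, by linarith⟩
  · rintro ⟨hpos, hc, hs⟩
    have hw : w S = ∑ x ∈ S, x := Finset.sum_congr rfl (fun x hx => abs_of_pos (hpos x hx))
    have hch : ch S = S.card := by
      unfold ch
      rw [Finset.sum_congr rfl (fun x hx => if_pos (hpos x hx))]
      simp
    exact ⟨by rw [hch, hc], by linarith⟩

lemma B_eq_Q (k : ℕ) (n N : ℤ) (h : 2 * n = 2 * N + k * (k+1)) :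
    (B k n).encard = (Q N).encard := by
  set m := N.toNat
  have hm : N ≤ m := Int.self_le_toNat N
  obtain ⟨t, ht⟩ := Int.even_mul_succ_self (m : ℤ)
  rw [B_iter k n m (n + m * k + t) (by linarith)]
  have := B_eq_D (k + m) N (n + m * k + t) (by push_cast; linarith) (by push_cast; linarith)
  push_cast at this
  rw [this, D_eq_P, P_eq_Q _ _ (by push_cast; linarith)]

lemma mex_mem {n : ℕ} (π : Nat.Partition n) : 0 < mex π ∧ mex π ∉ π.parts ∧ mex π ≤ n + 1 := by
  have h : n + 1 ∈ {m : ℕ | 0 < m ∧ m ∉ π.parts} := by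
    refine ⟨by omega, fun h => ?_⟩
    have := Multiset.single_le_sum (fun x _ => Nat.zero_le x) _ h
    rw [π.parts_sum] at this
    omega
  have h2 := Nat.sInf_mem ⟨_, h⟩
  exact ⟨h2.1, h2.2, Nat.sInf_le h⟩

lemma lt_mex {n : ℕ} (π : Nat.Partition n) (k : ℕ) :
    k < mex π ↔ ∀ i ∈ Finset.Icc 1 k, i ∈ π.parts := by
  constructor
  · intro h i hi
    rw [Finset.mem_Icc] at hi
    by_contra hc
    have : mex π ≤ i := Nat.sInf_le ⟨by omega, hc⟩
    omega
  · intro h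
    by_contra hc
    obtain ⟨h1, h2, _⟩ := mex_mem π
    exact h2 (h _ (by rw [Finset.mem_Icc]; omega))

def A (k n : ℕ) : Set (Nat.Partition n) := {π | k < mex π ∧ Odd (mex π + k)}

lemma A_split (k n : ℕ) :
    (A k n).encard + (A (k+1) n).encard = {π : Nat.Partition n | k < mex π}.encard := by
  rw [← Set.encard_union_eq]
  · congr 1
    ext π
    simp only [A, Set.mem_union, Set.mem_ofPred_eq]
    grind
  · rw [Set.disjoint_left]
    rintro π ⟨_, h⟩ ⟨_, h'⟩
    grind

lemma two_sum_Icc (k : ℕ) : 2 * ∑ i ∈ Finset.Icc 1 k, i = k * (k+1) := by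
  induction k with
  | zero => simp
  | succ k ih => rw [Finset.sum_Icc_succ_top (by omega), mul_add, ih]; ring

lemma mex_Q (k n : ℕ) (N : ℤ) (h : 2 * (n : ℤ) = 2 * N + k * (k+1)) :
    {π : Nat.Partition n | k < mex π}.encard = (Q N).encard := by
  have hs : ((Finset.Icc 1 k).val.sum : ℤ) = n - N := by
    have h1 : (Finset.Icc 1 k).val.sum = ∑ i ∈ Finset.Icc 1 k, i := by
      rw [Finset.sum, Multiset.map_id']
    have h2 := two_sum_Icc k
    rw [h1]
    zify at h2
    push_cast
    linarith
  have hinj : Function.Injective (fun π : Nat.Partition n => π.parts) :=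
    fun a b h => Nat.Partition.ext h
  have hinj2 : Function.Injective (fun s : Multiset ℕ => (Finset.Icc 1 k).val + s) :=
    fun a b h => by simpa using h
  rw [← hinj.encard_image, ← hinj2.encard_image (Q N)]
  congr 1
  ext s
  constructor
  · rintro ⟨π, hπ, rfl⟩
    have hπ' := (lt_mex π k).1 hπ
    have hle : (Finset.Icc 1 k).val ≤ π.parts := by
      rw [Multiset.le_iff_subset (Finset.nodup _)]
      exact fun i hi => hπ' i hi
    obtain ⟨t, ht⟩ := Multiset.le_iff_exists_add.1 hle
    refine ⟨t, ⟨?_, ?_⟩, ht.symm⟩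
    · intro x hx
      exact π.parts_pos (by rw [ht]; exact Multiset.mem_add.2 (Or.inr hx))
    · have h3 := π.parts_sum
      rw [ht, Multiset.sum_add] at h3
      omega
  · rintro ⟨t, ⟨h1, h2⟩, rfl⟩
    refine ⟨⟨(Finset.Icc 1 k).val + t, ?_, ?_⟩, ?_, rfl⟩
    · intro i hi
      rcases Multiset.mem_add.1 hi with hi | hi
      · exact (Finset.mem_Icc.1 (show i ∈ Finset.Icc 1 k from hi)).1
      · exact h1 i hi
    · rw [Multiset.sum_add]; omega
    · exact (lt_mex _ k).2 (fun i hi => Multiset.mem_add.2 (Or.inl hi))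

lemma ch_le_w (S : Finset ℤ) : ch S ≤ w S := by
  apply Finset.sum_le_sum
  intro x _
  split_ifs with h
  · rw [abs_of_pos h]; omega
  · have := abs_nonneg x; linarith

lemma C_eq_A (n j : ℕ) : ∀ k : ℕ, n + 1 ≤ k + j → (C k n).encard = (A k n).encard := by
  induction j with
  | zero =>
    intro k hk
    have h1 : C k n = ∅ := by
      ext S
      simp only [C, Set.mem_ofPred_eq, Set.mem_empty_iff_false, iff_false]
      rintro ⟨_, h1, h2⟩
      have := ch_le_w S
      omega
    have h2 : A k n = ∅ := by
      ext π
      simp only [A, Set.mem_ofPred_eq, Set.mem_empty_iff_false, iff_false]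
      rintro ⟨h1, _⟩
      have := (mex_mem π).2.2
      omega
    rw [h1, h2]; simp
  | succ j ih =>
    intro k hk
    have h1 := ih (k+1) (by omega)
    obtain ⟨t, ht⟩ := Int.even_mul_succ_self (k : ℤ)
    have h2 := B_eq_Q k n (n - t) (by linarith)
    rw [← mex_Q k n (n - t) (by linarith), ← A_split, B_split] at h2
    push_cast at h1
    rw [h1] at h2
    have hfin : (A (k+1) n).encard ≠ ⊤ := Set.encard_ne_top_iff.2 (Set.toFinite _)
    exact WithTop.add_right_cancel hfin h2

def T (n : ℤ) : Set (Finset ℤ) := {S | 0 ∉ S ∧ w S = n ∧ Odd (ch S)}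

lemma ch_card (S : Finset ℤ) : Even (ch S + S.card) := by
  have : ch S + S.card = ∑ x ∈ S, ((if 0 < x then (1 : ℤ) else -1) + 1) := by
    rw [Finset.sum_add_distrib]; simp [ch]
  rw [this]
  apply Finset.even_sum
  intro x _
  split_ifs <;> decide

def g : ℤ ↪ ℕ × Fin 2 where
  toFun x := (x.natAbs, if 0 < x then 0 else 1)
  inj' := by
    intro x y h
    simp only [Prod.mk.injEq] at h
    obtain ⟨h1, h2⟩ := h
    split_ifs at h2 <;> simp at h2 <;> omega

lemma g_apply (x : ℤ) : g x = (x.natAbs, if 0 < x then 0 else 1) := rfl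

lemma D2o_eq_T (n : ℕ) :
    {s : Finset (ℕ × Fin 2) | IsTCD n s ∧ Odd s.card}.encard = (T n).encard := by
  rw [← (Finset.map_injective g).encard_image (T n)]
  congr 1
  have hw : ∀ S : Finset ℤ, ((∑ p ∈ S.map g, p.1 : ℕ) : ℤ) = w S := by
    intro S
    rw [Finset.sum_map]
    simp [g_apply, w]
  have hodd : ∀ S : Finset ℤ, Odd S.card ↔ Odd (ch S) := by
    intro S
    have := ch_card S
    rw [Int.even_add] at this
    rw [← Int.not_even_iff_odd, this, ← Nat.not_even_iff_odd, Int.even_coe_nat]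
  ext s
  constructor
  · rintro ⟨⟨h1, h2⟩, h3⟩
    obtain ⟨S, rfl⟩ : ∃ S : Finset ℤ, S.map g = s := by
      refine ⟨s.image (fun p => if p.2 = 0 then (p.1 : ℤ) else -p.1), ?_⟩
      have hg : ∀ p ∈ s, g (if p.2 = 0 then (p.1 : ℤ) else -p.1) = p := by
        rintro ⟨a, c⟩ hp
        have := h1 _ hp
        simp only at this
        fin_cases c <;> simp [g_apply, this]
      rw [Finset.map_eq_image, Finset.image_image]
      conv_rhs => rw [← Finset.image_id (s := s)]
      exact Finset.image_congr (fun p hp => hg p hp)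
    refine ⟨S, ⟨?_, ?_, ?_⟩, rfl⟩
    · intro h0
      have := h1 (g 0) (Finset.mem_map_of_mem g h0)
      simp [g_apply] at this
    · rw [← hw, h2]
    · rwa [Finset.card_map, hodd] at h3
  · rintro ⟨S, ⟨h1, h2, h3⟩, rfl⟩
    refine ⟨⟨?_, ?_⟩, ?_⟩
    · intro p hp
      obtain ⟨x, hx, rfl⟩ := Finset.mem_map.1 hp
      have : x ≠ 0 := fun h => h1 (h ▸ hx)
      simpa [g_apply, Nat.pos_iff_ne_zero] using this
    · have := hw S
      rw [h2] at this
      exact_mod_cast this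
    · rwa [Finset.card_map, hodd]

def Tp (n : ℤ) (m : ℕ) : Set (Finset ℤ) :=
  {S | 0 ∉ S ∧ w S = n ∧ ∃ i : ℕ, i < m ∧ ch S = 2 * i + 1}

lemma Tp_sum (n : ℤ) (m : ℕ) :
    (Tp n m).encard = ∑ i ∈ Finset.range m, (C ((2 * i + 1 : ℕ) : ℤ) n).encard := by
  induction m with
  | zero => simp [Tp]
  | succ m ih =>
    rw [Finset.sum_range_succ, ← ih, ← Set.encard_union_eq]
    · congr 1
      ext S
      constructor
      · rintro ⟨h1, h2, i, hi, h3⟩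
        by_cases h : i = m
        · right; exact ⟨h1, by subst h; push_cast; exact h3, h2⟩
        · left; exact ⟨h1, h2, i, by omega, h3⟩
      · rintro (⟨h1, h2, i, hi, h3⟩ | ⟨h1, h2, h3⟩)
        · exact ⟨h1, h2, i, by omega, h3⟩
        · exact ⟨h1, h3, m, by omega, by push_cast at h2; exact h2⟩
    · rw [Set.disjoint_left]
      rintro S ⟨_, _, i, hi, h3⟩ ⟨_, h2, _⟩
      push_cast at h2
      omega

lemma T_eq (n : ℕ) : (T n).encard = 2 * (Tp n (n+1)).encard := by
  have hneg : ∀ S : Finset ℤ, 0 ∈ (Equiv.neg ℤ).finsetCongr S ↔ 0 ∈ S := by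
    intro S; simp
  have h2 : (Tp n (n+1)).encard =
      {S : Finset ℤ | 0 ∉ S ∧ w S = n ∧ ∃ i : ℕ, i < n + 1 ∧ ch S = -(2 * i + 1)}.encard := by
    apply encard_eq (Equiv.neg ℤ).finsetCongr
    intro S
    simp only [Tp, Set.mem_ofPred_eq, hneg]
    refine and_congr_right (fun h0 => ?_)
    obtain ⟨a, b⟩ := C_neg S h0
    rw [a, b]
    simp only [neg_inj]
  rw [two_mul]
  nth_rewrite 2 [h2]
  rw [← Set.encard_union_eq]
  · congr 1
    ext S
    constructor
    · rintro ⟨h0, h1, t, ht⟩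
      have h3 := ch_le_w S
      have h4 : - ch S ≤ w S := by
        obtain ⟨a, b⟩ := C_neg S h0
        rw [← a, ← b]; exact ch_le_w _
      by_cases hpos : 0 ≤ t
      · left
        exact ⟨h0, h1, t.toNat, by omega, by omega⟩
      · right
        exact ⟨h0, h1, (-t-1).toNat, by omega, by omega⟩
    · rintro (⟨h0, h1, i, _, h⟩ | ⟨h0, h1, i, _, h⟩)
      · exact ⟨h0, h1, i, h⟩
      · exact ⟨h0, h1, -i-1, by rw [h]; ring⟩
  · rw [Set.disjoint_left]
    rintro S ⟨_, _, i, _, h⟩ ⟨_, _, j, _, h'⟩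
    omega
end TCD

theorem sigma_even_mex_eq_D2o (n : ℕ) (hn : 0 < n) :
    ∑ π ∈ Finset.univ.filter (fun π : Nat.Partition n => Even (mex π)), mex π = D2o n := by
  classical
  have hA : ∀ k : ℕ, (TCD.A k n).encard =
      (((Finset.univ : Finset (Nat.Partition n)).filter
        (fun π => k < mex π ∧ Odd (mex π + k))).card : ℕ∞) := by
    intro k
    rw [← Set.encard_coe_eq_coe_finsetCard]
    congr 1
    ext π
    simp [TCD.A]
  have h : {s : Finset (ℕ × Fin 2) | IsTCD n s ∧ Odd s.card}.encard =
      ((∑ π ∈ Finset.univ.filter (fun π : Nat.Partition n => Even (mex π)), mex π : ℕ) : ℕ∞) := by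
    rw [TCD.D2o_eq_T, TCD.T_eq, TCD.Tp_sum]
    rw [Finset.sum_congr rfl (fun i _ => (TCD.C_eq_A n (n+1) (2*i+1) (by omega)).trans (hA _))]
    norm_cast
    simp only [Finset.card_filter]
    rw [Finset.sum_comm, Finset.mul_sum, Finset.sum_filter]
    apply Finset.sum_congr rfl
    intro π _
    rw [← Finset.card_filter]
    have hle := (TCD.mex_mem π).2.2
    split_ifs with he
    · have : (Finset.range (n+1)).filter (fun i => 2 * i + 1 < mex π ∧ Odd (mex π + (2 * i + 1)))
          = Finset.range (mex π / 2) := by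
        ext i
        simp only [Finset.mem_filter, Finset.mem_range]
        grind
      rw [this, Finset.card_range]
      exact Nat.two_mul_div_two_of_even he
    · rw [Finset.card_eq_zero.2, mul_zero]
      rw [Finset.filter_eq_empty_iff]
      rintro i _ ⟨_, h⟩
      grind
  unfold D2o Set.ncard
  rw [h, ENat.toNat_coe]
end

section
/- For every positive integer n, the number of two-colored distinct-parts partitions of n with an even number of parts, minus the number with an odd number of parts, equals Σ_{π ⊢ n} (−1)^{mex(π)−1} mex(π). -/
open Finset

namespace MexProof
open PowerSeries

noncomputable def Q (m : ℕ) : PowerSeries ℤ := ∏ i ∈ range m, (1 - X ^ (i + 1))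

def T (k : ℕ) : ℕ := ∑ i ∈ Finset.Icc 1 k, i

noncomputable def a : ℕ → ℕ → PowerSeries ℤ
  | 0, 0 => 1
  | 0, _ + 1 => 0
  | n + 1, 0 => (1 + X ^ (2 * n + 2) + X ^ (n + 1)) * a n 0 - X ^ (n + 1) * a n 1
  | n + 1, k + 1 => (1 + X ^ (2 * n + 2)) * a n (k + 1) - X ^ (n + 1) * (a n k + a n (k + 2))

lemma Q_succ (m : ℕ) : Q (m + 1) = Q m * (1 - X ^ (m + 1)) := by
  simp [Q, prod_range_succ]

lemma T_succ (k : ℕ) : T (k + 1) = T k + (k + 1) := by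
  simp [T, Finset.sum_Icc_succ_top]

lemma a_zero (n : ℕ) : ∀ k, n < k → a n k = 0 := by
  induction n with
  | zero => intro k hk; obtain ⟨k, rfl⟩ : ∃ j, k = j + 1 := ⟨k - 1, by omega⟩; simp [a]
  | succ n ih =>
    intro k hk
    obtain ⟨k, rfl⟩ : ∃ j, k = j + 1 := ⟨k - 1, by omega⟩
    simp [a, ih (k + 1) (by omega), ih k (by omega), ih (k + 2) (by omega)]

lemma closed (n : ℕ) : ∀ k d, k + d = n →
    Q d * Q (2 * k + d + 1) * a n k = (-1) ^ k * X ^ T k * Q (2 * n + 1) := by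
  induction n with
  | zero =>
    intro k d h
    obtain rfl : k = 0 := by omega
    obtain rfl : d = 0 := by omega
    simp [a, Q, T]
  | succ n ih =>
    have U : ∀ k d, k + d = n → Q d * Q (2 * k + d + 2) * a n (k + 1)
        = (1 - X ^ d) * ((-1) ^ (k + 1) * X ^ T (k + 1) * Q (2 * n + 1)) := by
      intro k d h
      rcases d with _ | d
      · rw [a_zero n (k + 1) (by omega)]; simp
      · have := ih (k + 1) d (by omega)
        rw [Q_succ d, ← this, show 2 * k + (d + 1) + 2 = 2 * (k + 1) + d + 1 by ring]
        ring
    intro k d h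
    have e2 : Q (2 * (n + 1) + 1) = Q (2 * n + 1) * (1 - X ^ (2 * n + 2)) * (1 - X ^ (2 * n + 3)) := by
      rw [show 2 * (n + 1) + 1 = 2 * n + 1 + 1 + 1 by ring, Q_succ, Q_succ]
    rw [e2]
    rcases k with _ | k
    · have hd : d = n + 1 := by omega
      subst hd
      have h0 := ih 0 n (by omega)
      have h1 := U 0 n (by omega)
      simp only [T_succ, show T 0 = 0 from rfl, a] at h0 h1 ⊢
      rw [show 2 * 0 + (n + 1) + 1 = n + 1 + 1 by ring, Q_succ (n + 1)]
      rw [show 2 * 0 + n + 1 = n + 1 by ring] at h0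
      rw [show 2 * 0 + n + 2 = n + 1 + 1 by ring, Q_succ (n + 1)] at h1
      rw [Q_succ n] at h0 h1 ⊢
      linear_combination (1 + X ^ (2 * n + 2) + X ^ (n + 1)) * (1 - X ^ (n + 1)) * (1 - X ^ (n + 2)) * h0
        - X ^ (n + 1) * (1 - X ^ (n + 1)) * h1
    · have hn : n = k + d := by omega
      have h0 := ih k d (by omega)
      have h1 := U k d (by omega)
      rw [show 2 * (k + 1) + d + 1 = 2 * k + d + 1 + 1 + 1 by ring, Q_succ (_ + 1), Q_succ]
      rw [show 2 * k + d + 2 = 2 * k + d + 1 + 1 by ring, Q_succ] at h1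
      rw [a]
      rcases d with _ | d
      · rw [a_zero n (k + 2) (by omega)]
        simp only [T_succ] at h0 h1 ⊢
        obtain rfl : n = k := by omega
        linear_combination (1 + X ^ (2 * (n + 0) + 2)) * (1 - X ^ (2 * n + 0 + 3)) * h1
          - X ^ (n + 0 + 1) * (1 - X ^ (2 * n + 0 + 2)) * (1 - X ^ (2 * n + 0 + 3)) * h0
      · have h2 := U (k + 1) d (by omega)
        rw [show 2 * (k + 1) + d + 2 = 2 * k + (d + 1) + 1 + 1 + 1 by ring, Q_succ (_ + 1), Q_succ (_ + 1)] at h2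
        simp only [T_succ] at h0 h1 h2 ⊢
        rw [Q_succ d] at h0 h1 ⊢
        subst hn
        linear_combination (1 + X ^ (2 * (k + (d + 1)) + 2)) * (1 - X ^ (2 * k + (d + 1) + 3)) * h1
          - X ^ (k + (d + 1) + 1) * (1 - X ^ (2 * k + (d + 1) + 2)) * (1 - X ^ (2 * k + (d + 1) + 3)) * h0
          - X ^ (k + (d + 1) + 1) * (1 - X ^ (d + 1)) * h2

lemma sum_step (f : ℕ → PowerSeries ℤ) (M : ℕ) :
    (∑ k ∈ range M, (2 * (k : PowerSeries ℤ) + 3) * (f k + f (k + 2))) + f 1 - f 0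
      = ∑ k ∈ range M, 2 * (2 * (k : PowerSeries ℤ) + 1) * f k
        + (2 * (M : PowerSeries ℤ) - 1) * f M + (2 * (M : PowerSeries ℤ) + 1) * f (M + 1) := by
  induction M with
  | zero => simp; ring
  | succ M ih =>
    rw [sum_range_succ, sum_range_succ]
    push_cast
    linear_combination ih

lemma sum_a (n : ℕ) : ∀ M, n < M →
    ∑ k ∈ range M, (2 * (k : PowerSeries ℤ) + 1) * a n k = Q n ^ 2 := by
  induction n with
  | zero =>
    intro M hM
    obtain ⟨M, rfl⟩ : ∃ j, M = j + 1 := ⟨M - 1, by omega⟩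
    rw [sum_range_succ']
    simp [a, Q]
  | succ n ih =>
    intro M hM
    obtain ⟨M, rfl⟩ : ∃ j, M = j + 1 := ⟨M - 1, by omega⟩
    have h1 := ih (M + 1) (by omega)
    have h0 := ih M (by omega)
    have h2 := sum_step (a n) M
    rw [a_zero n M (by omega), a_zero n (M + 1) (by omega)] at h2
    simp only [mul_assoc (2 : PowerSeries ℤ) (2 * _ + 1)] at h2
    rw [← mul_sum, h0] at h2
    rw [sum_range_succ'] at h1 ⊢
    have e : ∑ k ∈ range M, (2 * ((k + 1 : ℕ) : PowerSeries ℤ) + 1) * a (n + 1) (k + 1)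
      = (1 + X ^ (2 * n + 2)) * ∑ k ∈ range M, (2 * ((k + 1 : ℕ) : PowerSeries ℤ) + 1) * a n (k + 1)
       - X ^ (n + 1) * ∑ k ∈ range M, (2 * (k : PowerSeries ℤ) + 3) * (a n k + a n (k + 2)) := by
      rw [mul_sum, mul_sum, ← sum_sub_distrib]
      refine sum_congr rfl fun k _ => ?_
      rw [a]; push_cast; ring
    rw [e, a, Q_succ]
    push_cast at h1 ⊢
    linear_combination (1 + X ^ (2 * n + 2)) * h1 - X ^ (n + 1) * h2

/-- partitions containing a given multiset -/
lemma card_contain (n : ℕ) (s : Multiset ℕ) (hs : ∀ i ∈ s, 0 < i) (p : ℕ → Prop) [DecidablePred p]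
    (hp : ∀ i ∈ s, p i) :
    #{π : Nat.Partition n | s ≤ π.parts ∧ ∀ i ∈ π.parts, p i} =
      if s.sum ≤ n then #{π : Nat.Partition (n - s.sum) | ∀ i ∈ π.parts, p i} else 0 := by
  split_ifs with h
  · refine Finset.card_bij' (fun π hπ => ⟨π.parts - s, ?_, ?_⟩) (fun π hπ => ⟨π.parts + s, ?_, ?_⟩) ?_ ?_ ?_ ?_
    · intro i hi
      exact π.parts_pos (Multiset.mem_of_le (Multiset.sub_le_self _ _) hi)
    · simp only [mem_filter] at hπ
      have := congrArg Multiset.sum (Multiset.sub_add_cancel hπ.2.1)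
      rw [Multiset.sum_add, π.parts_sum] at this
      omega
    · intro i hi
      rcases Multiset.mem_add.1 hi with hi | hi
      · exact π.parts_pos hi
      · exact hs i hi
    · rw [Multiset.sum_add, π.parts_sum]; omega
    · intro π hπ
      simp only [mem_filter, mem_univ, true_and] at hπ ⊢
      intro i hi
      exact hπ.2 i (Multiset.mem_of_le (Multiset.sub_le_self _ _) hi)
    · intro π hπ
      simp only [mem_filter, mem_univ, true_and] at hπ ⊢
      refine ⟨Multiset.le_add_left _ _, ?_⟩
      intro i hi
      rcases Multiset.mem_add.1 hi with hi | hi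
      · exact hπ i hi
      · exact hp i hi
    · intro π hπ
      simp only [mem_filter, mem_univ, true_and] at hπ
      ext1
      exact Multiset.sub_add_cancel hπ.1
    · intro π hπ
      ext1
      simp
  · rw [card_eq_zero, filter_eq_empty_iff]
    rintro π - ⟨hle, -⟩
    obtain ⟨t, ht⟩ := Multiset.le_iff_exists_add.1 hle
    have := congrArg Multiset.sum ht
    rw [Multiset.sum_add, π.parts_sum] at this
    omega

noncomputable def PP (m : ℕ) : PowerSeries ℤ :=
  PowerSeries.mk fun n => (#{π : Nat.Partition n | ∀ i ∈ π.parts, m < i} : ℤ)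

lemma PP_succ (m : ℕ) : PP m * (1 - X ^ (m + 1)) = PP (m + 1) := by
  ext n
  rw [mul_sub, mul_one, map_sub, coeff_mul_X_pow']
  simp only [PP, coeff_mk]
  have h := card_contain n {m + 1} (by simp) (m < ·) (by simp)
  have h2 := Finset.card_filter_add_card_filter_not (s := {π : Nat.Partition n | ∀ i ∈ π.parts, m < i})
    (fun π => m + 1 ∈ π.parts)
  rw [filter_filter, filter_filter] at h2
  have e1 : (univ.filter fun π : Nat.Partition n => (∀ i ∈ π.parts, m < i) ∧ m + 1 ∈ π.parts)
     = univ.filter fun π : Nat.Partition n => {m + 1} ≤ π.parts ∧ ∀ i ∈ π.parts, m < i := by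
    ext π; simp [and_comm]
  have e2 : (univ.filter fun π : Nat.Partition n => (∀ i ∈ π.parts, m < i) ∧ ¬ m + 1 ∈ π.parts)
     = univ.filter fun π : Nat.Partition n => ∀ i ∈ π.parts, m + 1 < i := by
    ext π
    simp only [mem_filter, mem_univ, true_and]
    constructor
    · rintro ⟨h1, h2⟩ i hi
      have := h1 i hi
      have : i ≠ m + 1 := fun h => h2 (h ▸ hi)
      omega
    · intro h
      exact ⟨fun i hi => by have := h i hi; omega, fun hi => by have := h _ hi; omega⟩
  rw [e1, e2, h, Multiset.sum_singleton] at h2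
  rw [← h2]
  split_ifs <;> push_cast <;> ring

lemma PP_Q (m : ℕ) : PP 0 * Q m = PP m := by
  induction m with
  | zero => simp [Q]
  | succ m ih => rw [Q_succ, ← mul_assoc, ih, PP_succ]

lemma PP_dvd (m N : ℕ) (h : N ≤ m) : (X : PowerSeries ℤ) ^ (N + 1) ∣ PP m - 1 := by
  rw [X_pow_dvd_iff]
  intro n hn
  rw [map_sub, PP, coeff_mk, coeff_one]
  rcases n with _ | n
  · simp
  · rw [if_neg (by omega), sub_zero, Nat.cast_eq_zero, card_eq_zero, filter_eq_empty_iff]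
    intro π _ hπ
    have : π.parts ≠ 0 := by
      intro h0
      have := π.parts_sum
      simp [h0] at this
    obtain ⟨i, hi⟩ := Multiset.exists_mem_of_ne_zero this
    have := hπ i hi
    have := Nat.Partition.le_of_mem_parts hi
    omega

lemma a_congr (N k : ℕ) (hk : k ≤ N) :
    (X : PowerSeries ℤ) ^ (N + 1) ∣ a (2 * N) k - (-1) ^ k * (X ^ T k * PP 0) := by
  have h := closed (2 * N) k (2 * N - k) (by omega)
  obtain ⟨u, hu⟩ := PP_dvd (2 * N - k) N (by omega)
  obtain ⟨v, hv⟩ := PP_dvd (2 * k + (2 * N - k) + 1) N (by omega)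
  obtain ⟨w, hw⟩ := PP_dvd (2 * (2 * N) + 1) N (by omega)
  rw [← PP_Q] at hu hv hw
  generalize Q (2 * N - k) = A at *
  generalize Q (2 * k + (2 * N - k) + 1) = B at *
  generalize Q (2 * (2 * N) + 1) = C at *
  refine ⟨(-1) ^ k * X ^ T k * PP 0 * w - a (2 * N) k * (u * PP 0 * B + v), ?_⟩
  linear_combination (PP 0 ^ 2) * h - a (2 * N) k * PP 0 * B * hu - a (2 * N) k * hv
    + (-1) ^ k * X ^ T k * PP 0 * hw

lemma le_T (k : ℕ) : k ≤ T k := by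
  cases k with
  | zero => simp
  | succ k => rw [T_succ]; omega

lemma a_dvd (N k : ℕ) (hk : N < k) : (X : PowerSeries ℤ) ^ (N + 1) ∣ a (2 * N) k := by
  rcases lt_or_ge (2 * N) k with h | h
  · rw [a_zero _ _ h]; exact dvd_zero _
  have hc := closed (2 * N) k (2 * N - k) (by omega)
  have hunit : ∀ m, IsUnit (Q m) := by
    intro m
    rw [PowerSeries.isUnit_iff_constantCoeff]
    simp [Q, map_prod]
  have : (X : PowerSeries ℤ) ^ (N + 1) ∣ Q (2 * N - k) * Q (2 * k + (2 * N - k) + 1) * a (2 * N) k := by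
    rw [hc]
    exact Dvd.dvd.mul_right (Dvd.dvd.mul_left (pow_dvd_pow _ (by have := le_T k; omega)) _) _
  exact (((hunit _).mul (hunit _)).dvd_mul_left).1 this

lemma coeff_Q (N : ℕ) : coeff N (Q (2 * N) ^ 2)
    = ∑ k ∈ range (N + 1), (-1) ^ k * (2 * (k : ℤ) + 1) * coeff N (X ^ T k * PP 0) := by
  have hco : ∀ (k : ℕ) (f : PowerSeries ℤ), coeff N ((2 * (k : PowerSeries ℤ) + 1) * f)
      = (2 * (k : ℤ) + 1) * coeff N f := by
    intro k f
    have : (2 * (k : PowerSeries ℤ) + 1) = C (2 * (k : ℤ) + 1) := by simp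
    rw [this, coeff_C_mul]
  rw [← sum_a (2 * N) (2 * N + 1) (by omega), map_sum]
  rw [← Finset.sum_subset (s₁ := range (N + 1))]
  · refine sum_congr rfl fun k hk => ?_
    have hk : k ≤ N := by simpa [Nat.lt_succ_iff] using hk
    have h := X_pow_dvd_iff.1 (a_congr N k hk) N (by omega)
    have h3 : coeff N ((-1) ^ k * (X ^ T k * PP 0)) = (-1) ^ k * coeff N (X ^ T k * PP 0) := by
      rw [show ((-1 : PowerSeries ℤ) ^ k) = C ((-1) ^ k) by simp, coeff_C_mul]
    rw [map_sub, sub_eq_zero, h3] at h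
    rw [hco, h]; ring
  · intro x; simp; omega
  · intro k _ hk
    have h := X_pow_dvd_iff.1 (a_dvd N k (by simpa using hk)) N (by omega)
    rw [hco, h, mul_zero]

lemma lt_mex {n : ℕ} (π : Nat.Partition n) (k : ℕ) : k < mex π ↔ ∀ i ∈ Finset.Icc 1 k, i ∈ π.parts := by
  have hne : {m : ℕ | 0 < m ∧ m ∉ π.parts}.Nonempty :=
    ⟨n + 1, by omega, fun h => by have := Nat.Partition.le_of_mem_parts h; omega⟩
  constructor
  · intro h i hi
    by_contra hc
    have : mex π ≤ i := Nat.sInf_le ⟨by simp at hi; omega, hc⟩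
    simp at hi; omega
  · intro h
    by_contra hc
    have hm : 0 < mex π ∧ mex π ∉ π.parts := Nat.sInf_mem hne
    exact hm.2 (h _ (by simp; omega))

lemma mex_le {n : ℕ} (π : Nat.Partition n) : mex π ≤ n + 1 :=
  Nat.sInf_le ⟨by omega, fun h => by have := Nat.Partition.le_of_mem_parts h; omega⟩

lemma card_lt_mex (N k : ℕ) :
    (#{π : Nat.Partition N | k < mex π} : ℤ) = coeff N (X ^ T k * PP 0) := by
  have h := card_contain N (Finset.Icc 1 k).val (by simp; omega) (0 < ·) (by simp; omega)
  have e : (univ.filter fun π : Nat.Partition N => k < mex π) =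
      univ.filter fun π : Nat.Partition N => (Finset.Icc 1 k).val ≤ π.parts ∧ ∀ i ∈ π.parts, 0 < i := by
    ext π
    simp only [mem_filter, mem_univ, true_and, lt_mex]
    rw [Multiset.le_iff_subset (Finset.Icc 1 k).nodup]
    exact ⟨fun h => ⟨fun i hi => h i hi, fun i hi => π.parts_pos hi⟩, fun h i hi => h.1 hi⟩
  have hT : (Finset.Icc 1 k).val.sum = T k := by simp [T]
  rw [e, h, coeff_X_pow_mul', hT]
  simp [PP]

lemma alt (m : ℕ) : ∑ k ∈ range (m + 1), (-1 : ℤ) ^ k * (2 * (k : ℤ) + 1) = (-1) ^ m * (m + 1 : ℤ) := by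
  induction m with
  | zero => simp
  | succ m ih => rw [sum_range_succ, ih]; push_cast; ring

lemma rhs (N : ℕ) : ∑ π : Nat.Partition N, (-1 : ℤ) ^ (mex π - 1) * (mex π : ℤ)
    = coeff N (Q (2 * N) ^ 2) := by
  rw [coeff_Q]
  simp_rw [← card_lt_mex, card_filter]
  push_cast
  simp_rw [mul_sum]
  rw [sum_comm]
  refine sum_congr rfl fun π _ => ?_
  have h0 : 0 < mex π := (lt_mex π 0).2 (by simp)
  have h1 := mex_le π
  simp_rw [mul_ite, mul_one, mul_zero]
  rw [← sum_filter]
  have : (range (N + 1)).filter (fun k => k < mex π) = range (mex π - 1 + 1) := by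
    ext k; simp; omega
  rw [this, alt]
  congr 1
  push_cast [Nat.cast_sub h0]; ring

lemma Q_sq (m : ℕ) : Q m ^ 2 = ∏ p ∈ (Finset.Icc 1 m) ×ˢ (univ : Finset (Fin 2)), (1 - X ^ p.1) := by
  rw [prod_product]
  simp only [prod_const, card_univ, Fintype.card_fin]
  rw [prod_pow, Q]
  congr 1
  rw [range_eq_Ico, prod_Ico_add' (fun i => (1 - X ^ i : PowerSeries ℤ)) 0 m 1]
  rfl

lemma lhs (N m : ℕ) (h : N ≤ m) : (D2e N : ℤ) - D2o N = coeff N (Q m ^ 2) := by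
  set S := (Finset.Icc 1 m) ×ˢ (univ : Finset (Fin 2)) with hS
  have hmem : ∀ s, IsTCD N s ↔ s ∈ S.powerset ∧ ∑ p ∈ s, p.1 = N := by
    intro s
    simp only [IsTCD, mem_powerset]
    refine and_congr_left fun hs => ?_
    constructor
    · intro hp p hps
      have := single_le_sum (f := fun p : ℕ × Fin 2 => p.1) (fun _ _ => Nat.zero_le _) hps
      have := hp p hps
      simp only [hS, mem_product, mem_univ, and_true, Finset.mem_Icc]
      omega
    · intro hp p hps
      have := hp hps
      simp only [hS, mem_product, mem_univ, and_true, Finset.mem_Icc] at this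
      omega
  have he : D2e N = #{s ∈ S.powerset | ∑ p ∈ s, p.1 = N ∧ Even s.card} := by
    rw [D2e, ← Set.ncard_coe_finset]
    congr 1
    ext s
    simp only [Set.mem_ofPred_eq, hmem, coe_filter]
    tauto
  have ho : D2o N = #{s ∈ S.powerset | ∑ p ∈ s, p.1 = N ∧ Odd s.card} := by
    rw [D2o, ← Set.ncard_coe_finset]
    congr 1
    ext s
    simp only [Set.mem_ofPred_eq, hmem, coe_filter]
    tauto
  rw [he, ho, Q_sq, ← hS]
  simp_rw [sub_eq_add_neg (1 : PowerSeries ℤ)]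
  rw [prod_one_add, map_sum, card_filter, card_filter]
  push_cast
  rw [← sum_sub_distrib]
  refine sum_congr rfl fun s _ => ?_
  have : ∏ i ∈ s, -(X : PowerSeries ℤ) ^ i.1 = C ((-1) ^ s.card) * X ^ (∑ p ∈ s, p.1) := by
    rw [prod_neg, prod_pow_eq_pow_sum]; simp
  rw [this, coeff_C_mul, coeff_X_pow]
  rcases Nat.even_or_odd s.card with h | h
  · have h' := Nat.not_odd_iff_even.2 h
    simp [h, h', h.neg_one_pow, eq_comm]
  · have h' := Nat.not_even_iff_odd.2 h
    simp only [h, h', h.neg_one_pow, eq_comm (a := N)]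
    split_ifs <;> simp_all

end MexProof

theorem D2e_sub_D2o (n : ℕ) (hn : 0 < n) :
    (D2e n : ℤ) - D2o n =
      ∑ π : Nat.Partition n, (-1 : ℤ) ^ (mex π - 1) * (mex π : ℤ) := by
  rw [MexProof.rhs, MexProof.lhs n (2 * n) (by omega)]
end
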